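/- arXiv:math/0603575 — 4 statements merged into one kernel-verified Lean document; each statement's English description precedes it below -/
import Mathlib

section
/- Let (X, 𝓑, μ) be a probability space and T : X → X a measure-preserving map that is weakly mixing, i.e. for all measurable sets A, B one has (1/n)·∑_{k=0}^{n-1} |μ(T^{-k}A ∩ B) − μ(A)μ(B)| → 0 as n → ∞. Let ξ = {X₁, …, X_M} be a finite measurable partition of X with μ(X_i) > 0 for every i, and let Ξ : X → {1, …, M} be the coding map with Ξ(x) = i iff x ∈ X_i. Then for every pair of positive integers N, L and for μ^N-almost every tuple (x₁, …, x_N) ∈ X^N there exists an integer t₀ ≥ 0 such that Ξ(T^{t₀+t} x_i) = Ξ(T^{t₀+t} x_j) for all t ∈ {1, …, L} and all i, j ∈ {1, …, N}. -/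
open MeasureTheory Filter
open scoped ENNReal

theorem sum_range_natDist_le (a : ℕ → ℝ) (ha : ∀ m, 0 ≤ a m) (j n : ℕ) (hj : j < n) :
    ∑ k ∈ Finset.range n, a (Nat.dist j k) ≤ 2 * ∑ m ∈ Finset.range n, a m := by
  rw [← Finset.sum_range_add_sum_Ico _ hj.le, two_mul]
  refine add_le_add ?_ ?_
  · calc ∑ k ∈ Finset.range j, a (Nat.dist j k)
        ≤ ∑ k ∈ Finset.range (j + 1), a (Nat.dist j k) :=
          Finset.sum_le_sum_of_subset_of_nonneg (Finset.range_mono (Nat.le_succ j))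
            fun _ _ _ => ha _
      _ = ∑ k ∈ Finset.range (j + 1), a (j - k) :=
          Finset.sum_congr rfl fun k hk => by
            rw [Nat.dist_eq_sub_of_le_right (Nat.lt_succ_iff.1 (Finset.mem_range.1 hk))]
      _ = ∑ m ∈ Finset.range (j + 1), a m := Finset.sum_flip a
      _ ≤ _ := Finset.sum_le_sum_of_subset_of_nonneg (Finset.range_mono hj) fun _ _ _ => ha _
  · rw [Finset.sum_Ico_eq_sum_range]
    refine le_trans (Finset.sum_le_sum fun m _ => le_of_eq ?_)
      (Finset.sum_le_sum_of_subset_of_nonneg (Finset.range_mono (Nat.sub_le n j))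
        fun _ _ _ => ha _)
    rw [Nat.dist_eq_sub_of_le (Nat.le_add_right j m), Nat.add_sub_cancel_left]

/-- The second moment method for the number of visits to the sets `D 0, …, D (n - 1)`. -/
theorem sq_mul_measureReal_le_sum_correlations {Y : Type*} [MeasurableSpace Y] (ν : Measure Y)
    [IsProbabilityMeasure ν] (D : ℕ → Set Y) (hD : ∀ k, MeasurableSet (D k)) (d : ℝ)
    (hd : ∀ k, ν.real (D k) = d) (n : ℕ) :
    (n * d) ^ 2 * ν.real (⋂ k, (D k)ᶜ) ≤
      ∑ j ∈ Finset.range n, ∑ k ∈ Finset.range n, (ν.real (D j ∩ D k) - d ^ 2) := by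
  set f : ℕ → Y → ℝ := fun k => (D k).indicator 1 with hf
  have hE : MeasurableSet (⋂ k, (D k)ᶜ) := MeasurableSet.iInter fun k => (hD k).compl
  have hfi (k : ℕ) : Integrable (f k) ν := (integrable_const (1 : ℝ)).indicator (hD k)
  have hff (j k : ℕ) : (fun y => f j y * f k y) = (D j ∩ D k).indicator 1 := by
    rw [Set.inter_indicator_one]
    rfl
  have hffi (j k : ℕ) : Integrable (fun y => f j y * f k y) ν := by
    rw [hff]
    exact (integrable_const (1 : ℝ)).indicator ((hD j).inter (hD k))
  have hexp (j k : ℕ) : (fun y => (f j y - d) * (f k y - d)) =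
      fun y => f j y * f k y - d * f j y - d * f k y + d ^ 2 := by
    funext y
    ring
  have hi₁ (j k : ℕ) : Integrable (fun y => f j y * f k y - d * f j y) ν :=
    (hffi j k).sub ((hfi j).const_mul d)
  have hi₂ (j k : ℕ) : Integrable (fun y => f j y * f k y - d * f j y - d * f k y) ν :=
    (hi₁ j k).sub ((hfi k).const_mul d)
  have hi (j k : ℕ) : Integrable (fun y => (f j y - d) * (f k y - d)) ν := by
    rw [hexp]
    exact (hi₂ j k).add (integrable_const _)
  have hint (j k : ℕ) :
      ∫ y, (f j y - d) * (f k y - d) ∂ν = ν.real (D j ∩ D k) - d ^ 2 := by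
    rw [hexp, integral_add (hi₂ j k) (integrable_const _),
      integral_sub (hi₁ j k) ((hfi k).const_mul d),
      integral_sub (hffi j k) ((hfi j).const_mul d),
      integral_const_mul, integral_const_mul, hff,
      integral_indicator_one ((hD j).inter (hD k)), integral_indicator_one (hD j),
      integral_indicator_one (hD k), hd, hd, integral_const]
    simp
    ring
  calc (n * d) ^ 2 * ν.real (⋂ k, (D k)ᶜ)
      = ∫ y, (⋂ k, (D k)ᶜ).indicator (fun _ => (n * d) ^ 2) y ∂ν := by
        rw [integral_indicator_const _ hE, smul_eq_mul, mul_comm]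
    _ ≤ ∫ y, ∑ j ∈ Finset.range n, ∑ k ∈ Finset.range n, (f j y - d) * (f k y - d) ∂ν := by
        refine integral_mono ((integrable_const _).indicator hE)
          (integrable_finsetSum _ fun j _ => integrable_finsetSum _ fun k _ => hi j k)
          fun y => ?_
        simp only [← Finset.sum_mul_sum]
        by_cases hy : y ∈ ⋂ k, (D k)ᶜ
        · have h0 (k : ℕ) : f k y = 0 := Set.indicator_of_notMem (Set.mem_iInter.1 hy k) _
          simp only [Set.indicator_of_mem hy, h0, Finset.sum_const, Finset.card_range,
            nsmul_eq_mul]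
          exact le_of_eq (by ring)
        · rw [Set.indicator_of_notMem hy]
          exact mul_self_nonneg _
    _ = _ := by
        rw [integral_finsetSum _ fun j _ => integrable_finsetSum _ fun k _ => hi j k]
        refine Finset.sum_congr rfl fun j _ => ?_
        rw [integral_finsetSum _ fun k _ => hi j k]
        exact Finset.sum_congr rfl fun k _ => hint j k

theorem abs_pow_sub_pow_le_of_mem_Icc {x y : ℝ} (hx : x ∈ Set.Icc (0 : ℝ) 1)
    (hy : y ∈ Set.Icc (0 : ℝ) 1) (N : ℕ) : |x ^ N - y ^ N| ≤ N * |x - y| := by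
  refine (abs_pow_sub_pow_le x y N).trans ?_
  have h : max |x| |y| ^ (N - 1) ≤ 1 :=
    pow_le_one₀ (le_max_of_le_left (abs_nonneg x))
      (max_le (abs_le.2 ⟨by linarith [hx.1], hx.2⟩) (abs_le.2 ⟨by linarith [hy.1], hy.2⟩))
  calc |x - y| * N * max |x| |y| ^ (N - 1) ≤ |x - y| * N * 1 := by gcongr
    _ = N * |x - y| := by ring

theorem measureReal_preimage_iterate_inter {X : Type*} [MeasurableSpace X] {μ : Measure X}
    {T : X → X} (hT : MeasurePreserving T μ μ) {C : Set X} (hC : MeasurableSet C) (j k : ℕ) :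
    μ.real (T^[j] ⁻¹' C ∩ T^[k] ⁻¹' C) = μ.real (T^[Nat.dist j k] ⁻¹' C ∩ C) := by
  wlog h : k ≤ j generalizing j k
  · rw [Set.inter_comm, Nat.dist_comm, this k j (le_of_not_ge h)]
  obtain ⟨m, rfl⟩ := Nat.exists_eq_add_of_le h
  have hm : Nat.dist (k + m) k = m := by
    rw [Nat.dist_eq_sub_of_le_right h, Nat.add_sub_cancel_left]
  have hset : T^[k + m] ⁻¹' C ∩ T^[k] ⁻¹' C = T^[k] ⁻¹' (T^[m] ⁻¹' C ∩ C) := by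
    rw [add_comm k m, Function.iterate_add, Set.preimage_comp, Set.preimage_inter]
  rw [hm, hset, measureReal_def, measureReal_def, (hT.iterate k).measure_preimage
    (((hT.iterate m).measurable hC).inter hC).nullMeasurableSet]

/-- Under a weakly mixing map, almost every tuple of points has all its entries
simultaneously in a given set of positive measure at some time. -/
theorem ae_exists_iterate_mem_of_weakly_mixing
    {X : Type*} [MeasurableSpace X] (μ : Measure X) [IsProbabilityMeasure μ]
    (T : X → X) (hT : MeasurePreserving T μ μ) (C : Set X) (hC : MeasurableSet C)
    (hwm : Tendsto (fun n : ℕ => (1 / (n : ℝ)) * ∑ k ∈ Finset.range n,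
      |μ.real (T^[k] ⁻¹' C ∩ C) - μ.real C * μ.real C|) atTop (nhds 0))
    (hC0 : μ C ≠ 0) (N : ℕ) :
    ∀ᵐ x : Fin N → X ∂(Measure.pi fun _ => μ), ∃ k : ℕ, ∀ i, T^[k] (x i) ∈ C := by
  set ν : Measure (Fin N → X) := Measure.pi fun _ => μ with hν
  set c := μ.real C with hc
  have hcpos : 0 < c := ENNReal.toReal_pos hC0 (measure_ne_top _ _)
  set a : ℕ → ℝ := fun k => |μ.real (T^[k] ⁻¹' C ∩ C) - c * c| with ha
  set D : ℕ → Set (Fin N → X) := fun k => Set.univ.pi fun _ => T^[k] ⁻¹' C with hD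
  have hmT (k : ℕ) : MeasurableSet (T^[k] ⁻¹' C) := (hT.iterate k).measurable hC
  have hmD (k : ℕ) : MeasurableSet (D k) := MeasurableSet.univ_pi fun _ => hmT k
  have hνD (k : ℕ) : ν.real (D k) = c ^ N := by
    rw [measureReal_def, Measure.pi_pi, (hT.iterate k).measure_preimage hC.nullMeasurableSet]
    simp [hc, measureReal_def]
  have hνDD (j k : ℕ) : ν.real (D j ∩ D k) = μ.real (T^[Nat.dist j k] ⁻¹' C ∩ C) ^ N := by
    rw [← measureReal_preimage_iterate_inter hT hC, measureReal_def, ← Set.pi_inter_distrib,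
      Measure.pi_pi]
    simp [measureReal_def]
  have hcorr (j k : ℕ) : ν.real (D j ∩ D k) - (c ^ N) ^ 2 ≤ N * a (Nat.dist j k) := by
    rw [hνDD, ← pow_mul, mul_comm N 2, pow_mul, sq]
    exact (le_abs_self _).trans (abs_pow_sub_pow_le_of_mem_Icc
      ⟨measureReal_nonneg, measureReal_le_one⟩
      ⟨mul_self_nonneg c, mul_le_one₀ measureReal_le_one hcpos.le measureReal_le_one⟩ N)
  have hbound (n : ℕ) : (n * c ^ N) ^ 2 * ν.real (⋂ k, (D k)ᶜ) ≤
      n * (N * (2 * ∑ m ∈ Finset.range n, a m)) := by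
    refine (sq_mul_measureReal_le_sum_correlations ν D hmD _ hνD n).trans ?_
    calc _ ≤ ∑ j ∈ Finset.range n, ∑ k ∈ Finset.range n, N * a (Nat.dist j k) :=
          Finset.sum_le_sum fun j _ => Finset.sum_le_sum fun k _ => hcorr j k
      _ ≤ ∑ j ∈ Finset.range n, N * (2 * ∑ m ∈ Finset.range n, a m) := by
          refine Finset.sum_le_sum fun j hj => ?_
          rw [← Finset.mul_sum]
          exact mul_le_mul_of_nonneg_left
            (sum_range_natDist_le a (fun _ => abs_nonneg _) j n (Finset.mem_range.1 hj))
            (Nat.cast_nonneg N)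
      _ = _ := by rw [Finset.sum_const, Finset.card_range, nsmul_eq_mul]
  have hlim : (c ^ N) ^ 2 * ν.real (⋂ k, (D k)ᶜ) ≤ 0 := by
    have h2 := hwm.const_mul (2 * N : ℝ)
    rw [mul_zero] at h2
    refine ge_of_tendsto h2 ?_
    filter_upwards [eventually_gt_atTop 0] with n hn
    have hn' : (0 : ℝ) < n := Nat.cast_pos.2 hn
    refine le_of_mul_le_mul_left ?_ (pow_pos hn' 2)
    calc (n : ℝ) ^ 2 * ((c ^ N) ^ 2 * ν.real (⋂ k, (D k)ᶜ))
        = (n * c ^ N) ^ 2 * ν.real (⋂ k, (D k)ᶜ) := by ring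
      _ ≤ n * (N * (2 * ∑ m ∈ Finset.range n, a m)) := hbound n
      _ = _ := by
        field_simp
  have hzero : ν.real (⋂ k, (D k)ᶜ) = 0 :=
    le_antisymm (nonpos_of_mul_nonpos_right hlim (by positivity)) measureReal_nonneg
  have hnull : ν (⋂ k, (D k)ᶜ) = 0 := (measureReal_eq_zero_iff (measure_ne_top _ _)).1 hzero
  refine measure_mono_null (fun x hx => ?_) hnull
  refine Set.mem_iInter.2 fun k hk => hx ⟨k, fun i => hk i (Set.mem_univ i)⟩

/-- **Raw coding theorem** (Blank, "On Raw Coding of Chaotic Dynamics").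
If `T` is a weakly mixing measure-preserving transformation of a probability space
`(X, μ)` and `ξ = {X₁, …, X_M}` is a finite measurable partition with all elements of
positive measure, with coding map `Ξ`, then for all positive integers `N, L` and
`μ^N`-almost every tuple `(x₁, …, x_N)` there is `t₀ ≥ 0` with
`Ξ(T^{t₀+t} x_i) = Ξ(T^{t₀+t} x_j)` for all `t ∈ {1, …, L}` and all `i, j`. -/
theorem raw_coding_of_weakly_mixing
    {X : Type*} [MeasurableSpace X] (μ : Measure X) [IsProbabilityMeasure μ]
    (T : X → X) (hT : MeasurePreserving T μ μ)
    (hwm : ∀ A B : Set X, MeasurableSet A → MeasurableSet B →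
      Tendsto (fun n : ℕ => (1 / (n : ℝ)) * ∑ k ∈ Finset.range n,
          |(μ (T^[k] ⁻¹' A ∩ B)).toReal - (μ A).toReal * (μ B).toReal|)
        atTop (nhds 0))
    (M : ℕ) (Xs : Fin M → Set X)
    (hmeas : ∀ i, MeasurableSet (Xs i))
    (hdisj : Pairwise (Function.onFun Disjoint Xs))
    (hcover : (⋃ i, Xs i) = Set.univ)
    (hpos : ∀ i, 0 < μ (Xs i))
    (Ξ : X → Fin M) (hΞ : ∀ x, x ∈ Xs (Ξ x))
    (N L : ℕ) (hN : 0 < N) (hL : 0 < L) :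
    ∀ᵐ x : Fin N → X ∂(Measure.pi fun _ => μ),
      ∃ t₀ : ℕ, ∀ t ∈ Finset.Icc 1 L, ∀ i j : Fin N,
        Ξ (T^[t₀ + t] (x i)) = Ξ (T^[t₀ + t] (x j)) := by
  let C : (Fin L → Fin M) → Set X := fun w => ⋂ s : Fin L, T^[s + 1] ⁻¹' Xs (w s)
  have hmC (w : Fin L → Fin M) : MeasurableSet (C w) :=
    MeasurableSet.iInter fun s => (hT.iterate _).measurable (hmeas _)
  have hcode {y : X} {i : Fin M} (hy : y ∈ Xs i) : Ξ y = i := by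
    by_contra hne
    exact Set.disjoint_left.1 (hdisj hne) (hΞ y) hy
  obtain ⟨w, hw⟩ : ∃ w, μ (C w) ≠ 0 := by
    by_contra! h
    have hcov : (⋃ w, C w) = Set.univ := Set.eq_univ_of_forall fun x =>
      Set.mem_iUnion.2 ⟨fun s => Ξ (T^[s + 1] x), Set.mem_iInter.2 fun s => hΞ _⟩
    have h0 := measure_iUnion_null h
    rw [hcov, measure_univ] at h0
    exact one_ne_zero h0
  filter_upwards [ae_exists_iterate_mem_of_weakly_mixing μ T hT (C w) (hmC w)
    (hwm _ _ (hmC w) (hmC w)) hw N] with x hx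
  obtain ⟨k, hk⟩ := hx
  refine ⟨k, fun t ht => ?_⟩
  obtain ⟨ht1, htL⟩ := Finset.mem_Icc.1 ht
  have key (i : Fin N) : Ξ (T^[k + t] (x i)) = w ⟨t - 1, by omega⟩ := by
    have h := Set.mem_iInter.1 (hk i) ⟨t - 1, by omega⟩
    refine hcode ?_
    have ht' : t - 1 + 1 + k = k + t := by omega
    rwa [Set.mem_preimage, ← Function.iterate_add_apply, ht'] at h
  intro i j
  rw [key i, key j]
end

section
/- Let T : [0,1] → [0,1] be defined by T(x) = 2x for 0 ≤ x < 1/4, T(x) = 2x − 1/2 for 1/4 ≤ x < 3/4, and T(x) = 2x − 1 otherwise, with Lebesgue measure m (this system is NOT ergodic). Let ξ = {X₁, …, X_M} be a finite measurable partition of [0,1] with m(X_i) > 0 for every i, such that X₁ = [1/2 − 2^{−k}, 1/2 + 2^{−k}) for some positive integer k, and let Ξ be the associated coding map. Then for every pair of positive integers N, L and for m^N-almost every tuple (x₁, …, x_N) ∈ [0,1]^N there exists an integer t₀ ≥ 0 such that Ξ(T^{t₀+t} x_i) = Ξ(T^{t₀+t} x_j) for all t ∈ {1, …, L} and all i, j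 ∈ {1, …, N}. Hence weak mixing is not a necessary condition for the simultaneous-coding conclusion. -/
open MeasureTheory
open scoped ENNReal

/-- The interval map `T x = 2x` on `[0, 1/4)`, `T x = 2x - 1/2` on `[1/4, 3/4)`,
and `T x = 2x - 1` otherwise. -/
noncomputable def blankMap (x : ℝ) : ℝ :=
  if 0 ≤ x ∧ x < 1/4 then 2 * x
  else if 1/4 ≤ x ∧ x < 3/4 then 2 * x - 1/2
  else 2 * x - 1

/-- The first `t` iterates only double the distance to `1/2`, as long as it stays below `1/2`. -/
lemma blankMap_iterate_mem_Ico (t : ℕ) :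
    ∀ r u : ℝ, r * 2 ^ t ≤ 1 / 2 → u ∈ Set.Ico (1 / 2 - r) (1 / 2 + r) →
      blankMap^[t] u ∈ Set.Ico (1 / 2 - r * 2 ^ t) (1 / 2 + r * 2 ^ t) := by
  induction t with
  | zero => intro r u _ hu; simpa using hu
  | succ t ih =>
    intro r u hr hu
    obtain ⟨hu₁, hu₂⟩ := hu
    have hr₀ : 0 < r := by linarith
    have hpow : (1 : ℝ) ≤ 2 ^ t := one_le_pow₀ (by norm_num)
    rw [pow_succ] at hr ⊢
    have hr₁ : r ≤ 1 / 4 := by nlinarith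
    have hTu : blankMap u = 2 * u - 1 / 2 := by
      unfold blankMap
      rw [if_neg (by rintro ⟨_, h⟩; linarith), if_pos ⟨by linarith, by linarith⟩]
    have h := ih (2 * r) (blankMap u) (by linarith)
      (by rw [hTu]; constructor <;> linarith)
    rw [Function.iterate_succ_apply, show r * (2 ^ t * 2) = 2 * r * 2 ^ t by ring]
    exact h

/-- Each half of the unit interval is invariant, and there the `n`-th preimages of an interval
of radius `c` contain intervals of radius `c / 2 ^ n` at distance at most `1 / 2 ^ n`
from any point. -/
lemma exists_ball_blankMap_iterate {a p c : ℝ} (ha : a = 0 ∨ a = 1 / 2)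
    (hpc : ∀ y, |y - p| ≤ c → y ∈ Set.Ico a (a + 1 / 2)) (hp : p ∈ Set.Ico a (a + 1 / 2))
    (n : ℕ) :
    ∀ x ∈ Set.Icc a (a + 1 / 2), ∃ w, |w - x| ≤ (1 / 2) ^ n ∧
      ∀ y, |y - w| ≤ c * (1 / 2) ^ n →
        y ∈ Set.Ico a (a + 1 / 2) ∧ |blankMap^[n] y - p| ≤ c := by
  induction n with
  | zero =>
    rintro x ⟨hx₁, hx₂⟩
    obtain ⟨hp₁, hp₂⟩ := hp
    refine ⟨p, by rw [abs_le]; constructor <;> norm_num <;> linarith, fun y hy => ?_⟩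
    rw [pow_zero, mul_one] at hy
    exact ⟨hpc y hy, hy⟩
  | succ n ih =>
    rintro x ⟨hx₁, hx₂⟩
    have branch : ∀ b : ℝ, 2 * x - b ∈ Set.Icc a (a + 1 / 2) →
        (∀ y, 2 * y - b ∈ Set.Ico a (a + 1 / 2) →
          y ∈ Set.Ico a (a + 1 / 2) ∧ blankMap y = 2 * y - b) →
        ∃ w, |w - x| ≤ (1 / 2) ^ (n + 1) ∧ ∀ y, |y - w| ≤ c * (1 / 2) ^ (n + 1) →
          y ∈ Set.Ico a (a + 1 / 2) ∧ |blankMap^[n + 1] y - p| ≤ c := by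
      intro b hxb hb
      obtain ⟨w, hwx, hw⟩ := ih _ hxb
      rw [abs_le] at hwx
      refine ⟨(w + b) / 2, ?_, fun y hy => ?_⟩
      · rw [abs_le, pow_succ]
        constructor <;> linarith [hwx.1, hwx.2]
      · rw [abs_le, pow_succ] at hy
        have hy' := hw (2 * y - b)
          (by rw [abs_le]; constructor <;> linarith [hy.1, hy.2])
        obtain ⟨hyI, hTy⟩ := hb y hy'.1
        rw [Function.iterate_succ_apply, hTy]
        exact ⟨hyI, hy'.2⟩
    rcases le_total x (a + 1 / 4) with hx | hx
    · refine branch a ⟨by linarith, by linarith⟩ fun y hy => ?_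
      obtain ⟨hy₁, hy₂⟩ := hy
      refine ⟨⟨by linarith, by linarith⟩, ?_⟩
      unfold blankMap
      rcases ha with rfl | rfl
      · rw [if_pos ⟨by linarith, by linarith⟩]; ring
      · rw [if_neg (by rintro ⟨_, h⟩; linarith), if_pos ⟨by linarith, by linarith⟩]
    · refine branch (a + 1 / 2) ⟨by linarith, by linarith⟩ fun y hy => ?_
      obtain ⟨hy₁, hy₂⟩ := hy
      refine ⟨⟨by linarith, by linarith⟩, ?_⟩
      unfold blankMap
      rcases ha with rfl | rfl
      · rw [if_neg (by rintro ⟨_, h⟩; linarith), if_pos ⟨by linarith, by linarith⟩]; ring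
      · rw [if_neg (by rintro ⟨_, h⟩; linarith), if_neg (by rintro ⟨_, h⟩; linarith)]; ring

/-- Near every point of the unit interval, at scale `2 ^ (-n)`, there is a proportionally large
interval that `blankMap^[n]` maps into the neighbourhood of radius `r` of `1/2`. -/
lemma exists_ball_blankMap_iterate_mem_Ico {r : ℝ} (hr : 0 < r) (hr' : r ≤ 1 / 4) (n : ℕ)
    {x : ℝ} (hx : x ∈ Set.Icc (0 : ℝ) 1) :
    ∃ w, |w - x| ≤ (1 / 2) ^ n ∧ ∀ y, |y - w| ≤ r / 4 * (1 / 2) ^ n →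
      blankMap^[n] y ∈ Set.Ico (1 / 2 - r) (1 / 2 + r) := by
  obtain ⟨hx₀, hx₁⟩ := hx
  have half : ∀ a p : ℝ, (a = 0 ∨ a = 1 / 2) → x ∈ Set.Icc a (a + 1 / 2) →
      |p - 1 / 2| ≤ r / 2 → (∀ y, |y - p| ≤ r / 4 → y ∈ Set.Ico a (a + 1 / 2)) →
      ∃ w, |w - x| ≤ (1 / 2) ^ n ∧ ∀ y, |y - w| ≤ r / 4 * (1 / 2) ^ n →
        blankMap^[n] y ∈ Set.Ico (1 / 2 - r) (1 / 2 + r) := by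
    intro a p ha hxa hp hpa
    obtain ⟨w, hwx, hw⟩ := exists_ball_blankMap_iterate ha hpa
      (hpa p (by rw [sub_self, abs_zero]; positivity)) n x hxa
    refine ⟨w, hwx, fun y hy => ?_⟩
    have h := (hw y hy).2
    rw [abs_le] at h hp
    constructor <;> linarith [h.1, h.2, hp.1, hp.2]
  rcases le_total x (1 / 2) with hx | hx
  · refine half 0 (1 / 2 - r / 2) (Or.inl rfl) ⟨hx₀, by linarith⟩
      (by rw [abs_le]; constructor <;> linarith) fun y hy => ?_
    rw [abs_le] at hy
    constructor <;> linarith [hy.1, hy.2]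
  · refine half (1 / 2) (1 / 2 + r / 2) (Or.inr rfl) ⟨hx, by linarith⟩
      (by rw [abs_le]; constructor <;> linarith) fun y hy => ?_
    rw [abs_le] at hy
    constructor <;> linarith [hy.1, hy.2]

/-- A set is null if near almost each of its points it misses a proportionally large ball at
arbitrarily small scales. -/
lemma volume_eq_zero_of_porous {ι : Type*} [Fintype ι] {S A : Set (ι → ℝ)}
    (hA : MeasurableSet A) (hSA : S ⊆ A) (K : ℝ) (δ : ℕ → ℝ)
    (hδ : Filter.Tendsto δ Filter.atTop (nhdsWithin 0 (Set.Ioi 0)))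
    (hS : ∀ x ∈ A, ∀ n, ∃ w, x ∈ Metric.closedBall w (K * δ n) ∧
      S ∩ Metric.closedBall w (δ n) = ∅) :
    volume S = 0 := by
  have hmem : ∀ᵐ x ∂(volume.restrict S), x ∈ A :=
    ae_restrict_of_ae_restrict_of_subset hSA (ae_restrict_mem hA)
  have hfalse : ∀ᵐ x ∂(volume.restrict S), False := by
    filter_upwards [hmem, IsUnifLocDoublingMeasure.ae_tendsto_measure_inter_div
      (volume : Measure (ι → ℝ)) S K] with x hxA hx
    choose w hw hwS using hS x hxA
    have h := hx w δ hδ (Filter.Eventually.of_forall hw)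
    simp only [hwS, measure_empty, ENNReal.zero_div] at h
    exact zero_ne_one (tendsto_nhds_unique tendsto_const_nhds h)
  simpa using hfalse

/-- For the (nonergodic) map `blankMap` on `[0,1]` with Lebesgue measure and any
finite measurable partition `ξ = {X₁, …, X_M}` of `[0,1]` with elements of
positive measure whose first element is `X₁ = [1/2 - 2^{-k}, 1/2 + 2^{-k})`,
the simultaneous-coding conclusion still holds: for all positive integers
`N, L` and `m^N`-a.e. tuple `(x₁, …, x_N)` there is `t₀ ≥ 0` with
`Ξ(T^{t₀+t} x_i) = Ξ(T^{t₀+t} x_j)` for all `t ∈ {1, …, L}` and all `i, j`.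
Hence weak mixing is not necessary for this conclusion. -/
theorem raw_coding_for_nonergodic_blankMap
    (M : ℕ) (hM : 0 < M)
    (Xs : Fin M → Set ℝ)
    (hmeas : ∀ i, MeasurableSet (Xs i))
    (hdisj : Pairwise (Function.onFun Disjoint Xs))
    (hcover : (⋃ i, Xs i) = Set.Icc (0:ℝ) 1)
    (hpos : ∀ i, 0 < (volume.restrict (Set.Icc (0:ℝ) 1)) (Xs i))
    (k : ℕ) (hk : 0 < k)
    (hX1 : Xs ⟨0, hM⟩ = Set.Ico (1/2 - 1/2^k : ℝ) (1/2 + 1/2^k : ℝ))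
    (Ξ : ℝ → Fin M) (hΞ : ∀ x ∈ Set.Icc (0:ℝ) 1, x ∈ Xs (Ξ x))
    (N L : ℕ) (hN : 0 < N) (hL : 0 < L) :
    ∀ᵐ x : Fin N → ℝ ∂(Measure.pi fun _ => volume.restrict (Set.Icc (0:ℝ) 1)),
      ∃ t₀ : ℕ, ∀ t ∈ Finset.Icc 1 L, ∀ i j : Fin N,
        Ξ (blankMap^[t₀ + t] (x i)) = Ξ (blankMap^[t₀ + t] (x j)) := by
  have hpowk : (1 : ℝ) / 2 ^ k ≤ 1 / 2 := by
    simpa using one_div_pow_le_one_div_pow_of_le (one_le_two (α := ℝ)) hk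
  set r : ℝ := 1 / 2 ^ k * (1 / 2) ^ L with hr
  have hr₀ : 0 < r := by positivity
  have hpowL : (1 / 2 : ℝ) ^ L ≤ 1 / 2 :=
    pow_le_of_le_one (by norm_num) (by norm_num) hL.ne'
  have hr₁ : r ≤ 1 / 4 := by
    calc r ≤ 1 / 2 * (1 / 2) := by rw [hr]; gcongr
      _ = 1 / 4 := by norm_num
  have hcode : ∀ z ∈ Set.Ico (1/2 - 1/2^k : ℝ) (1/2 + 1/2^k : ℝ), Ξ z = ⟨0, hM⟩ := by
    intro z hz
    by_contra hne
    have hzI : z ∈ Set.Icc (0 : ℝ) 1 :=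
      ⟨by linarith [hz.1], by linarith [hz.2]⟩
    exact Set.disjoint_left.1 (hdisj hne) (hΞ z hzI) (hX1 ▸ hz)
  have hstay : ∀ t ≤ L, ∀ u ∈ Set.Ico (1 / 2 - r) (1 / 2 + r),
      Ξ (blankMap^[t] u) = ⟨0, hM⟩ := by
    intro t ht u hu
    have hrt : r * 2 ^ t ≤ 1 / 2 ^ k := by
      calc r * 2 ^ t ≤ r * 2 ^ L := by gcongr; norm_num
        _ = 1 / 2 ^ k := by rw [hr, mul_assoc, ← mul_pow]; norm_num
    have h := blankMap_iterate_mem_Ico t r u (hrt.trans hpowk) hu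
    exact hcode _ ⟨by linarith [h.1], by linarith [h.2]⟩
  rw [← Measure.restrict_pi_pi, ae_restrict_iff' (MeasurableSet.univ_pi fun _ => measurableSet_Icc)]
  rw [ae_iff]
  refine volume_eq_zero_of_porous (A := Set.univ.pi fun _ : Fin N => Set.Icc (0 : ℝ) 1)
    (MeasurableSet.univ_pi fun _ => measurableSet_Icc)
    (fun x hx => (Classical.not_imp.1 hx).1) (4 / r) (fun n => r / 4 * (1 / 2) ^ n) ?_ ?_
  · refine tendsto_nhdsWithin_iff.2 ⟨?_, Filter.Eventually.of_forall fun n => ?_⟩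
    · simpa using (tendsto_pow_atTop_nhds_zero_of_lt_one (r := (1 / 2 : ℝ)) (by norm_num)
        (by norm_num)).const_mul (r / 4)
    · exact Set.mem_Ioi.2 (by positivity)
  · intro x hx n
    choose w hwx hw using fun i =>
      exists_ball_blankMap_iterate_mem_Ico hr₀ hr₁ n (hx i (Set.mem_univ i))
    refine ⟨w, ?_, ?_⟩
    · rw [Metric.mem_closedBall, dist_pi_le_iff (by positivity)]
      intro i
      rw [dist_comm, Real.dist_eq, show 4 / r * (r / 4 * (1 / 2) ^ n) = (1 / 2 : ℝ) ^ n by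
        field_simp]
      exact hwx i
    · rw [Set.eq_empty_iff_forall_notMem]
      rintro y ⟨hyS, hyw⟩
      rw [Metric.mem_closedBall, dist_pi_le_iff (by positivity)] at hyw
      refine hyS fun _ => ⟨n, fun t ht i j => ?_⟩
      have hzero : ∀ i, Ξ (blankMap^[n + t] (y i)) = ⟨0, hM⟩ := by
        intro i
        rw [add_comm, Function.iterate_add_apply]
        exact hstay t (Finset.mem_Icc.1 ht).2 _ (hw i (y i) (hyw i))
      rw [hzero i, hzero j]
end

section
/- Let T : [0,1] → [0,1] be defined by T(x) = 2x for 0 ≤ x < 1/4, T(x) = 2x − 1/2 for 1/4 ≤ x < 3/4, and T(x) = 2x − 1 otherwise, and let ξ = {X₁, …, X_M} be a finite measurable partition of [0,1] with X₁ = [1/2 − 2^{−k}, 1/2 + 2^{−k}) for some positive integer k. Then for every n ≥ 0 the n-th refinement ξ^{(n)} (with ξ^{(0)} = ξ and ξ^{(n+1)} = ξ^{(n)} ∩ T^{-1}ξ^{(n)}) has an element containing an open neighborhood of the point 1/2. -/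
open MeasureTheory

/-- `blankMap` expands by a factor `2` around its fixed point `1/2`, as long as the orbit
has not left the middle branch. -/
theorem blankMap_iterate_of_near_half {x : ℝ} {s : ℕ} (h : 2 ^ s * |x - 1/2| < 1/2) :
    blankMap^[s] x = 1/2 + 2 ^ s * (x - 1/2) := by
  induction s with
  | zero => simp
  | succ s ih =>
    have h4 : 2 ^ s * |x - 1/2| < 1/4 := by
      rw [pow_succ] at h
      linarith
    have habs : |2 ^ s * (x - 1/2)| < 1/4 := by
      rwa [abs_mul, abs_of_pos (by positivity : (0:ℝ) < 2 ^ s)]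
    rw [abs_lt] at habs
    rw [Function.iterate_succ_apply', ih (by linarith), blankMap,
      if_neg (fun hc => by linarith [hc.2, habs.1]),
      if_pos ⟨by linarith [habs.1], by linarith [habs.2]⟩, pow_succ]
    ring

/-- For the map `blankMap` and a finite measurable partition `ξ = {X₁, …, X_M}`
of `[0,1]` with `X₁ = [1/2 - 2^{-k}, 1/2 + 2^{-k})`, every refinement `ξ^{(n)}`
has an element containing an open neighborhood of the point `1/2`: there are a
word `w` and `ε > 0` such that every point of `(1/2 - ε, 1/2 + ε)` visits
`X_{w s}` at time `s` for all `s ≤ n` (i.e. the neighborhood is contained in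
the element `⋂_{s=0}^{n} T^{-s} X_{w s}` of `ξ^{(n)}`). -/
theorem refinement_has_element_containing_nbhd_of_half
    (M : ℕ) (hM : 0 < M)
    (Xs : Fin M → Set ℝ)
    (hmeas : ∀ i, MeasurableSet (Xs i))
    (hdisj : Pairwise (Function.onFun Disjoint Xs))
    (hcover : (⋃ i, Xs i) = Set.Icc (0:ℝ) 1)
    (k : ℕ) (hk : 0 < k)
    (hX1 : Xs ⟨0, hM⟩ = Set.Ico (1/2 - 1/2^k : ℝ) (1/2 + 1/2^k : ℝ)) :
    ∀ n : ℕ, ∃ (w : ℕ → Fin M) (ε : ℝ), 0 < ε ∧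
      ∀ x ∈ Set.Ioo (1/2 - ε : ℝ) (1/2 + ε : ℝ), ∀ s ≤ n,
        blankMap^[s] x ∈ Xs (w s) := by
  intro n
  refine ⟨fun _ => ⟨0, hM⟩, 1 / 2 ^ (n + k), by positivity, fun x hx s hs => ?_⟩
  have hx' : |x - 1/2| < 1 / 2 ^ (n + k) := by
    rw [abs_lt]
    constructor <;> linarith [hx.1, hx.2]
  have hlt : 2 ^ s * |x - 1/2| < 1 / 2 ^ k :=
    calc (2:ℝ) ^ s * |x - 1/2| ≤ 2 ^ n * |x - 1/2| := by gcongr; norm_num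
      _ < 2 ^ n * (1 / 2 ^ (n + k)) := by gcongr
      _ = 1 / 2 ^ k := by rw [pow_add]; field_simp
  have hk2 : (1:ℝ) / 2 ^ k ≤ 1 / 2 := by
    gcongr
    exact le_self_pow₀ one_le_two hk.ne'
  have hmem : |2 ^ s * (x - 1/2)| < 1 / 2 ^ k := by
    rwa [abs_mul, abs_of_pos (by positivity : (0:ℝ) < 2 ^ s)]
  rw [hX1, blankMap_iterate_of_near_half (hlt.trans_le hk2)]
  rw [abs_lt] at hmem
  constructor <;> linarith [hmem.1, hmem.2]
end

section
/- Let T : [0,1] → [0,1] be defined by T(x) = 2x for 0 ≤ x < 1/4, T(x) = 2x − 1/2 for 1/4 ≤ x < 3/4, and T(x) = 2x − 1 otherwise, with Lebesgue measure m, and fix a positive integer N. Let B ⊆ [0,1]^N be the N-th power of an open interval around 1/2, and let A ⊆ [0,1]^N be any measurable set with m^N(A) > 0. Then there exists a positive integer t₀ such that (T^{⊗N})^{t₀} A ∩ B ≠ ∅; more precisely, m^N(A ∩ (T^{⊗N})^{-t₀} B) > 0. -/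
open MeasureTheory
open scoped ENNReal

/-- The `N`-fold product map `T^{⊗N}`. -/
noncomputable def blankMapPi (N : ℕ) : (Fin N → ℝ) → Fin N → ℝ :=
  fun x i => blankMap (x i)

/-- The product Lebesgue measure `m^N` on `[0,1]^N`. -/
noncomputable def cubeMeasure (N : ℕ) : Measure (Fin N → ℝ) :=
  Measure.pi fun _ => volume.restrict (Set.Icc (0:ℝ) 1)

open Filter Topology Metric Set in
/-- Every positive-measure set in `ℝ^N` is met in positive measure by sets occupying a fixed
proportion `c` of the balls of radii `r t → 0` around a density point. -/
lemma exists_forall_eventually_measure_inter_pos {ι : Type*} [Fintype ι] {s : Set (ι → ℝ)}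
    (hs : volume s ≠ 0) {r : ℕ → ℝ} (hr : Tendsto r atTop (𝓝[>] 0)) {c : ℝ≥0∞} (hc : c ≠ 0) :
    ∃ x ∈ s, ∀ᶠ t in atTop, ∀ J : Set (ι → ℝ), MeasurableSet J → J ⊆ closedBall x (r t) →
      c * volume (closedBall x (r t)) ≤ volume J → 0 < volume (s ∩ J) := by
  have : ∃ᵐ x ∂volume, x ∈ s := by
    rwa [frequently_ae_mem_iff]
  obtain ⟨x, hx, hxs⟩ :=
    ((ae_imp_of_ae_restrict (Besicovitch.ae_tendsto_measure_inter_div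
      (volume : Measure (ι → ℝ)) s)).and_frequently this).exists
  refine ⟨x, hxs, ?_⟩
  have hlt : 1 - c < 1 := ENNReal.sub_lt_self ENNReal.one_ne_top one_ne_zero hc
  filter_upwards [((hx hxs).comp hr).eventually_const_lt hlt,
    hr.eventually self_mem_nhdsWithin] with t ht hrt J hJ hJball hcJ
  by_contra! hzero
  have hball : volume (closedBall x (r t)) ≠ 0 := (measure_closedBall_pos _ _ hrt).ne'
  have hball' : volume (closedBall x (r t)) ≠ ∞ := measure_closedBall_lt_top.ne
  refine ht.not_ge (ENNReal.div_le_of_le_mul ?_)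
  calc volume (s ∩ closedBall x (r t))
      ≤ volume (s ∩ J ∪ closedBall x (r t) \ J) := measure_mono fun y hy ↦ by
        by_cases hyJ : y ∈ J
        · exact Or.inl ⟨hy.1, hyJ⟩
        · exact Or.inr ⟨hy.2, hyJ⟩
    _ ≤ volume (s ∩ J) + volume (closedBall x (r t) \ J) := measure_union_le _ _
    _ = volume (closedBall x (r t)) - volume J := by
        rw [nonpos_iff_eq_zero.mp hzero, zero_add, measure_sdiff hJball hJ.nullMeasurableSet
          (ne_top_of_le_ne_top hball' (measure_mono hJball))]
    _ ≤ volume (closedBall x (r t)) - c * volume (closedBall x (r t)) :=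
        tsub_le_tsub_left hcJ _
    _ = (1 - c) * volume (closedBall x (r t)) := by
        rw [ENNReal.sub_mul fun _ _ ↦ hball', one_mul]

/-- Around each point of `[0,1)`, the iterate `blankMap^[t]` is affine of slope `2 ^ t` on a
half-open interval of length `2 ^ (-t) / 2` that it maps onto the half `[e, e + 1/2)`
containing the point. -/
lemma exists_cell_blankMap_iterate (t : ℕ) : ∀ x ∈ Set.Ico (0 : ℝ) 1, ∃ u e : ℝ,
    (e = 0 ∨ e = 1/2) ∧ x ∈ Set.Ico e (e + 1/2) ∧ x ∈ Set.Ico u (u + (2 ^ t)⁻¹ / 2) ∧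
    e ≤ u ∧ u + (2 ^ t)⁻¹ / 2 ≤ e + 1/2 ∧
    ∀ y ∈ Set.Ico u (u + (2 ^ t)⁻¹ / 2), blankMap^[t] y = 2 ^ t * (y - u) + e := by
  induction t with
  | zero =>
    rintro x ⟨hx0, hx1⟩
    rcases lt_or_ge x (1/2) with h | h
    · exact ⟨0, 0, by norm_num, by constructor <;> linarith,
        by constructor <;> norm_num <;> linarith, by norm_num, by norm_num, fun y _ ↦ by simp⟩
    · exact ⟨1/2, 1/2, by norm_num, by constructor <;> linarith,
        by constructor <;> norm_num <;> linarith, by norm_num, by norm_num, fun y _ ↦ by simp⟩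
  | succ t ih =>
    rintro x ⟨hx0, hx1⟩
    obtain ⟨d, e, he, hde, hxe, hTx, hd⟩ : ∃ d e : ℝ,
        (e = 0 ∨ e = 1/2) ∧ d ∈ Set.Icc e (e + 1/2) ∧
        x ∈ Set.Ico e (e + 1/2) ∧ 2 * x - d ∈ Set.Ico e (e + 1/2) ∧
        ∀ y : ℝ, 2 * y - d ∈ Set.Ico e (e + 1/2) → blankMap y = 2 * y - d := by
      have key : (0 ≤ x ∧ x < 1/4) ∨ (1/4 ≤ x ∧ x < 1/2) ∨ (1/2 ≤ x ∧ x < 3/4) ∨ 3/4 ≤ x := by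
        grind
      unfold blankMap
      rcases key with h | h | h | h
      · refine ⟨0, 0, ?_⟩
        grind
      · refine ⟨1/2, 0, ?_⟩
        grind
      · refine ⟨1/2, 1/2, ?_⟩
        grind
      · refine ⟨1, 1/2, ?_⟩
        grind
    have hTx' : 2 * x - d ∈ Set.Ico (0 : ℝ) 1 := by grind
    obtain ⟨u, e', he', hxe', hxu, heu, hue, haff⟩ := ih _ hTx'
    obtain rfl : e' = e := by grind
    have hpow : ((2 : ℝ) ^ (t + 1))⁻¹ = (2 ^ t)⁻¹ / 2 := by rw [pow_succ, mul_inv]; ring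
    have hcell : ∀ y ∈ Set.Ico ((u + d) / 2) ((u + d) / 2 + (2 ^ (t + 1))⁻¹ / 2),
        2 * y - d ∈ Set.Ico u (u + (2 ^ t)⁻¹ / 2) := by
      rintro y ⟨h1, h2⟩
      rw [hpow] at h2
      constructor <;> linarith
    have hle : ∀ y ∈ Set.Ico u (u + (2 ^ t)⁻¹ / 2), y ∈ Set.Ico e' (e' + 1/2) := fun y hy ↦
      ⟨heu.trans hy.1, hy.2.trans_le hue⟩
    refine ⟨(u + d) / 2, e', he', hxe, ?_, ?_, ?_, fun y hy ↦ ?_⟩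
    · rw [hpow]
      constructor <;> linarith [hxu.1, hxu.2]
    · linarith [hde.1]
    · rw [hpow]
      linarith [hde.2]
    · rw [Function.iterate_succ_apply, hd y (hle _ (hcell y hy)), haff _ (hcell y hy)]
      ring

/-- Preimages of a neighborhood of `1/2` under `blankMap^[t]` contain intervals of length
comparable to `2 ^ (-t)` at distance at most `2 ^ (-t) / 2` from any point of `[0,1)`. -/
lemma exists_Ioo_subset_blankMap_preimage {a b q : ℝ} (hq : 0 < q) (hqa : q ≤ 1/2 - a)
    (hqb : q ≤ b - 1/2) (hb : b ≤ 1) (t : ℕ) {x : ℝ} (hx : x ∈ Set.Ico (0 : ℝ) 1) :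
    ∃ v : ℝ, Set.Ioo v (v + q * (2 ^ t)⁻¹) ⊆
      Metric.closedBall x ((2 ^ t)⁻¹ / 2) ∩ blankMap^[t] ⁻¹' Set.Ioo a b := by
  obtain ⟨u, e, he, hxe, hxu, heu, hue, haff⟩ := exists_cell_blankMap_iterate t x hx
  have hp : (0 : ℝ) < 2 ^ t := by positivity
  have hp' : (0 : ℝ) < (2 ^ t)⁻¹ := by positivity
  have hpp : (2 : ℝ) ^ t * (2 ^ t)⁻¹ = 1 := mul_inv_cancel₀ hp.ne'
  obtain ⟨w, hw0, hw1, hwa, hwb⟩ :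
      ∃ w : ℝ, 0 ≤ w ∧ w + q ≤ 1/2 ∧ a ≤ w + e ∧ w + q + e ≤ b := by
    rcases he with rfl | rfl
    · exact ⟨1/2 - q, by linarith, by linarith, by linarith, by linarith⟩
    · exact ⟨0, by linarith, by linarith, by linarith, by linarith⟩
  refine ⟨u + w * (2 ^ t)⁻¹, fun y ⟨hy1, hy2⟩ ↦ ?_⟩
  have h1 : w < 2 ^ t * (y - u) := by
    have := mul_lt_mul_of_pos_left hy1 hp
    linear_combination this - w * hpp
  have h2 : 2 ^ t * (y - u) < w + q := by
    have := mul_lt_mul_of_pos_left hy2 hp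
    linear_combination this + (w + q) * hpp
  have hyu : y ∈ Set.Ico u (u + (2 ^ t)⁻¹ / 2) := by
    constructor <;> nlinarith
  refine ⟨?_, ?_⟩
  · rw [Real.closedBall_eq_Icc]
    constructor <;> linarith [hyu.1, hyu.2, hxu.1, hxu.2]
  · rw [Set.mem_preimage, haff y hyu]
    constructor <;> linarith

lemma blankMapPi_iterate_apply (N t : ℕ) (x : Fin N → ℝ) (i : Fin N) :
    (blankMapPi N)^[t] x i = blankMap^[t] (x i) := by
  induction t generalizing x with
  | zero => rfl
  | succ t ih => rw [Function.iterate_succ_apply, Function.iterate_succ_apply, ih]; rfl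

lemma cubeMeasure_eq_restrict_Ico (N : ℕ) :
    cubeMeasure N = volume.restrict (Set.univ.pi fun _ ↦ Set.Ico (0 : ℝ) 1) := by
  simp only [cubeMeasure, restrict_Ico_eq_restrict_Icc.symm, volume_pi, Measure.restrict_pi_pi]

/-- For the product map `T^{⊗N}` of `blankMap` on `[0,1]^N` with product
Lebesgue measure `m^N`: if `B` is the `N`-th power of an open interval around
`1/2` (contained in `[0,1]`), then for every measurable `A ⊆ [0,1]^N` with
`m^N(A) > 0` there is a positive integer `t₀` such that
`(T^{⊗N})^{t₀} A ∩ B ≠ ∅`; more precisely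
`m^N(A ∩ (T^{⊗N})^{-t₀} B) > 0`. -/
theorem blankMapPi_hits_neighborhood_of_diagonal_point
    (N : ℕ) (hN : 0 < N)
    (a b : ℝ) (ha : 0 ≤ a) (hb : b ≤ 1) (hab : a < 1/2 ∧ (1/2 : ℝ) < b)
    (A : Set (Fin N → ℝ)) (hA : MeasurableSet A) (hApos : 0 < cubeMeasure N A) :
    ∃ t₀ : ℕ, 0 < t₀ ∧
      ((blankMapPi N)^[t₀] '' A ∩ {x | ∀ i, x i ∈ Set.Ioo a b}).Nonempty ∧
      0 < cubeMeasure N (A ∩ (blankMapPi N)^[t₀] ⁻¹' {x | ∀ i, x i ∈ Set.Ioo a b}) := by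
  obtain ⟨hab1, hab2⟩ := hab
  obtain ⟨q, hq, hqa, hqb⟩ : ∃ q : ℝ, 0 < q ∧ q ≤ 1/2 - a ∧ q ≤ b - 1/2 :=
    ⟨min (1/2 - a) (b - 1/2), lt_min (by linarith) (by linarith), min_le_left _ _, min_le_right _ _⟩
  have hcube : MeasurableSet (Set.univ.pi fun _ : Fin N ↦ Set.Ico (0 : ℝ) 1) :=
    MeasurableSet.univ_pi fun _ ↦ measurableSet_Ico
  rw [cubeMeasure_eq_restrict_Ico] at hApos ⊢
  rw [Measure.restrict_apply' hcube] at hApos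
  have hr : Filter.Tendsto (fun t : ℕ ↦ ((2 : ℝ) ^ t)⁻¹ / 2) Filter.atTop
      (nhdsWithin 0 (Set.Ioi 0)) := by
    refine tendsto_nhdsWithin_iff.mpr ⟨?_, Filter.Eventually.of_forall fun t ↦ ?_⟩
    · simpa using
        (tendsto_pow_atTop_atTop_of_one_lt (one_lt_two (α := ℝ))).inv_tendsto_atTop.div_const 2
    · exact Set.mem_Ioi.mpr (by positivity)
  obtain ⟨x, hxA, hx⟩ := exists_forall_eventually_measure_inter_pos hApos.ne' hr
    (c := ENNReal.ofReal q ^ N) (by simp [hq])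
  obtain ⟨t, hxt, ht⟩ := (hx.and (Filter.eventually_gt_atTop 0)).exists
  choose v hv using fun i ↦
    exists_Ioo_subset_blankMap_preimage hq hqa hqb hb t (hxA.2 i (Set.mem_univ i))
  have hpos := hxt (Set.univ.pi fun i ↦ Set.Ioo (v i) (v i + q * (2 ^ t)⁻¹))
    (MeasurableSet.univ_pi fun _ ↦ measurableSet_Ioo)
    (by
      rw [closedBall_pi _ (by positivity)]
      exact Set.pi_mono fun i _ ↦ (hv i).trans Set.inter_subset_left)
    (by
      rw [Real.volume_pi_closedBall _ (by positivity), Real.volume_pi_Ioo]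
      simp only [add_sub_cancel_left, Finset.prod_const, Finset.card_univ, Fintype.card_fin,
        ENNReal.ofReal_mul hq.le]
      rw [mul_div_cancel₀ _ two_ne_zero,
        ENNReal.ofReal_pow (by positivity), mul_pow])
  have hB : 0 < volume.restrict (Set.univ.pi fun _ ↦ Set.Ico (0 : ℝ) 1)
      (A ∩ (blankMapPi N)^[t] ⁻¹' {x | ∀ i, x i ∈ Set.Ioo a b}) := by
    rw [Measure.restrict_apply' hcube]
    refine hpos.trans_le (measure_mono fun y hy ↦ ⟨⟨hy.1.1, fun i ↦ ?_⟩, hy.1.2⟩)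
    rw [blankMapPi_iterate_apply]
    exact (hv i (hy.2 i (Set.mem_univ i))).2
  obtain ⟨y, hyA, hyB⟩ := nonempty_of_measure_ne_zero hB.ne'
  exact ⟨t, ht, ⟨_, Set.mem_image_of_mem _ hyA, hyB⟩, hB⟩
end
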